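/- arXiv:1704.07541 — 2 statements merged into one kernel-verified Lean document; each statement's English description precedes it below -/
import Mathlib

section
/- Let θ ∈ (0, π/2), set H = cos θ·H₁ + sin θ·H₂, and define τ̃_H = −Σ_{λ∈Σ₁⁺∪Σ₂⁺} m(λ)·λ/⟨λ,H⟩ and τ̃_{2,H} = 2(n₁+n₂)·τ̃_H − Σ_{λ∈Σ₁⁺∪Σ₂⁺} m(λ)·(⟨λ,τ̃_H⟩/⟨λ,H⟩²)·λ. Then there exists c ∈ ℝ with τ̃_{2,H} = c·H (the biharmonicity condition for the orbit Ad(K)H in the unit sphere) if and only if cos²θ = n₁/(n₁+n₂) or cos²θ = 1/2. Moreover, if cos²θ = 1/2 and n₁ ≠ n₂, then τ̃_H is not a scalar multiple of H, i.e. the tangential part of the tension field is nonzero, so the corresponding product of minimal R-spaces is a proper (non-minimal) biharmonic submanifold of the unit sphere. -/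
open scoped RealInnerProductSpace

section
variable {V : Type*} [NormedAddCommGroup V] [InnerProductSpace ℝ V]

/-- If `⟪x, H⟫ = r * ⟪x, u⟫` on `P`, then the sum defining the tension field at `H` is `r⁻¹` times
the one at `u`. -/
lemma sum_div_inner_smul_of_inner_eq_mul {P : Finset V} {m : V → ℕ} {n r : ℝ} {u H : V}
    (hmin : ∑ x ∈ P, ((m x : ℝ) / ⟪x, u⟫) • x = n • u)
    (hH : ∀ x ∈ P, ⟪x, H⟫ = r * ⟪x, u⟫) :
    ∑ x ∈ P, ((m x : ℝ) / ⟪x, H⟫) • x = (n / r) • u := by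
  have h : (n / r) • u = r⁻¹ • (n • u) := by rw [smul_smul]; congr 1; ring
  rw [h, ← hmin, Finset.smul_sum]
  refine Finset.sum_congr rfl fun x hx => ?_
  rw [smul_smul, hH x hx, inv_mul_eq_div, div_div, mul_comm r]

/-- The analogue of `sum_div_inner_smul_of_inner_eq_mul` for the second sum in the bitension field,
when also `⟪x, τ⟫ = t * ⟪x, u⟫` on `P`. -/
lemma sum_mul_inner_div_sq_smul_of_inner_eq_mul {P : Finset V} {m : V → ℕ} {n r t : ℝ} {u H τ : V}
    (hmin : ∑ x ∈ P, ((m x : ℝ) / ⟪x, u⟫) • x = n • u)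
    (hu : ∀ x ∈ P, ⟪x, u⟫ ≠ 0) (hr : r ≠ 0)
    (hH : ∀ x ∈ P, ⟪x, H⟫ = r * ⟪x, u⟫) (hτ : ∀ x ∈ P, ⟪x, τ⟫ = t * ⟪x, u⟫) :
    ∑ x ∈ P, ((m x : ℝ) * ⟪x, τ⟫ / ⟪x, H⟫ ^ 2) • x = (n * t / r ^ 2) • u := by
  have h : (n * t / r ^ 2) • u = (t / r ^ 2) • (n • u) := by rw [smul_smul]; congr 1; ring
  rw [h, ← hmin, Finset.smul_sum]
  refine Finset.sum_congr rfl fun x hx => ?_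
  have := hu x hx
  rw [smul_smul, hH x hx, hτ x hx]
  congr 1
  field_simp

/-- In an orthonormal plane, `a • u + b • v` is a multiple of `c • u + s • v` with `c ≠ 0` iff the
determinant of the coordinates vanishes. -/
lemma exists_eq_smul_add_smul_iff {u v : V} (hu : ‖u‖ = 1) (hv : ‖v‖ = 1) (huv : ⟪u, v⟫ = 0)
    {a b c s : ℝ} (hc : c ≠ 0) :
    (∃ k : ℝ, a • u + b • v = k • (c • u + s • v)) ↔ a * s = b * c := by
  constructor
  · rintro ⟨k, hk⟩
    have hvu : ⟪v, u⟫ = 0 := by rw [real_inner_comm, huv]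
    have h₁ := congrArg (fun x => ⟪u, x⟫) hk
    have h₂ := congrArg (fun x => ⟪v, x⟫) hk
    simp only [inner_add_right, inner_smul_right, real_inner_self_eq_norm_sq, hu, hv, huv,
      hvu] at h₁ h₂
    linear_combination s * h₁ - c * h₂
  · intro h
    refine ⟨a / c, ?_⟩
    rw [smul_add, smul_smul, smul_smul, div_mul_cancel₀ _ hc]
    congr 2
    field_simp
    linarith

end

/-- The scalar form of the biharmonicity condition. -/
lemma bitension_det_eq_zero_iff {n₁ n₂ c s : ℝ} (hn : n₁ + n₂ ≠ 0) (hc : c ≠ 0) (hs : s ≠ 0)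
    (hcs : s ^ 2 + c ^ 2 = 1) :
    (2 * (n₁ + n₂) * -(n₁ / c) - n₁ * -(n₁ / c) / c ^ 2) * s =
        (2 * (n₁ + n₂) * -(n₂ / s) - n₂ * -(n₂ / s) / s ^ 2) * c ↔
      c ^ 2 = n₁ / (n₁ + n₂) ∨ c ^ 2 = 1 / 2 := by
  have hs2 : s ^ 2 = 1 - c ^ 2 := by linarith
  have key : ((2 * (n₁ + n₂) * -(n₁ / c) - n₁ * -(n₁ / c) / c ^ 2) * s -
      (2 * (n₁ + n₂) * -(n₂ / s) - n₂ * -(n₂ / s) / s ^ 2) * c) * (c ^ 3 * s ^ 3) =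
      (c ^ 2 * (n₁ + n₂) - n₁) ^ 2 * (1 - 2 * c ^ 2) := by
    have : ((2 * (n₁ + n₂) * -(n₁ / c) - n₁ * -(n₁ / c) / c ^ 2) * s -
      (2 * (n₁ + n₂) * -(n₂ / s) - n₂ * -(n₂ / s) / s ^ 2) * c) * (c ^ 3 * s ^ 3) =
      (-2 * (n₁ + n₂) * n₁ * c ^ 2 + n₁ ^ 2) * (s ^ 2) ^ 2 -
      (-2 * (n₁ + n₂) * n₂ * s ^ 2 + n₂ ^ 2) * (c ^ 2) ^ 2 := by
      field_simp
      ring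
    rw [this, hs2]
    ring
  rw [← sub_eq_zero, ← mul_left_inj' (show c ^ 3 * s ^ 3 ≠ 0 by positivity), key, zero_mul,
    mul_eq_zero, sq_eq_zero_iff, eq_div_iff hn, sub_eq_zero]
  refine or_congr Iff.rfl ⟨fun h => by linarith, fun h => by linarith⟩

/-- In the setting of a product of two minimal R-spaces: `H₁, H₂`
orthonormal, `P₁, P₂` disjoint nonempty finite sets of nonzero vectors with the root
conditions, positive multiplicities `m`, `nᵢ = Σ_{x∈Pᵢ} m x`, and the minimality
conditions `Σ_{x∈Pᵢ} m x · x/⟪x,Hᵢ⟫ = nᵢ·Hᵢ`.  For `θ ∈ (0, π/2)`,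
`H = cos θ·H₁ + sin θ·H₂`, `τ̃_H = −Σ_{x∈P₁∪P₂} m x · x/⟪x,H⟫`, and
`τ̃_{2,H} = 2(n₁+n₂)·τ̃_H − Σ_{x∈P₁∪P₂} m x·(⟪x,τ̃_H⟫/⟪x,H⟫²)·x`:
there is `c ∈ ℝ` with `τ̃_{2,H} = c·H` iff `cos²θ = n₁/(n₁+n₂)` or `cos²θ = 1/2`;
moreover if `cos²θ = 1/2` and `n₁ ≠ n₂` then `τ̃_H` is not a scalar multiple of `H`
(so the orbit is proper biharmonic, not minimal). -/
theorem biharmonic_orbit_condition {V : Type*} [NormedAddCommGroup V] [DecidableEq V]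
    [InnerProductSpace ℝ V] [FiniteDimensional ℝ V]
    (H₁ H₂ : V) (hH₁ : ‖H₁‖ = 1) (hH₂ : ‖H₂‖ = 1) (hH₁₂ : ⟪H₁, H₂⟫ = 0)
    (P₁ P₂ : Finset V) (hdisj : Disjoint P₁ P₂)
    (hP₁ne : P₁.Nonempty) (hP₂ne : P₂.Nonempty)
    (hP₁0 : ∀ x ∈ P₁, x ≠ 0) (hP₂0 : ∀ y ∈ P₂, y ≠ 0)
    (hP₁ : ∀ x ∈ P₁, 0 < ⟪x, H₁⟫ ∧ ⟪x, H₂⟫ = 0)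
    (hP₂ : ∀ y ∈ P₂, 0 < ⟪y, H₂⟫ ∧ ⟪y, H₁⟫ = 0)
    (m : V → ℕ) (hm : ∀ x ∈ P₁ ∪ P₂, 0 < m x)
    (n₁ n₂ : ℕ) (hn₁ : n₁ = ∑ x ∈ P₁, m x) (hn₂ : n₂ = ∑ y ∈ P₂, m y)
    (hmin₁ : ∑ x ∈ P₁, ((m x : ℝ) / ⟪x, H₁⟫) • x = (n₁ : ℝ) • H₁)
    (hmin₂ : ∑ y ∈ P₂, ((m y : ℝ) / ⟪y, H₂⟫) • y = (n₂ : ℝ) • H₂)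
    (θ : ℝ) (hθ : θ ∈ Set.Ioo 0 (Real.pi / 2))
    (H : V) (hH : H = Real.cos θ • H₁ + Real.sin θ • H₂)
    (τ' : V) (hτ' : τ' = -∑ x ∈ P₁ ∪ P₂, ((m x : ℝ) / ⟪x, H⟫) • x)
    (τ₂ : V) (hτ₂ : τ₂ = (2 * ((n₁ : ℝ) + n₂)) • τ' -
      ∑ x ∈ P₁ ∪ P₂, ((m x : ℝ) * ⟪x, τ'⟫ / ⟪x, H⟫ ^ 2) • x) :
    ((∃ c : ℝ, τ₂ = c • H) ↔
      Real.cos θ ^ 2 = (n₁ : ℝ) / ((n₁ : ℝ) + n₂) ∨ Real.cos θ ^ 2 = 1 / 2) ∧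
    (Real.cos θ ^ 2 = 1 / 2 → n₁ ≠ n₂ → ¬∃ c : ℝ, τ' = c • H) := by
  have hc : 0 < Real.cos θ := Real.cos_pos_of_mem_Ioo ⟨by linarith [hθ.1, Real.pi_pos], hθ.2⟩
  have hs : 0 < Real.sin θ := Real.sin_pos_of_pos_of_lt_pi hθ.1 (by linarith [hθ.2, Real.pi_pos])
  have hcs := Real.sin_sq_add_cos_sq θ
  have hn₁0 : 0 < n₁ :=
    hn₁ ▸ Finset.sum_pos (fun x hx => hm x (Finset.mem_union_left _ hx)) hP₁ne
  have hn : (n₁ : ℝ) + n₂ ≠ 0 := by positivity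
  have hH₁' : ∀ x ∈ P₁, ⟪x, H⟫ = Real.cos θ * ⟪x, H₁⟫ := fun x hx => by
    simp [hH, inner_add_right, inner_smul_right, (hP₁ x hx).2]
  have hH₂' : ∀ x ∈ P₂, ⟪x, H⟫ = Real.sin θ * ⟪x, H₂⟫ := fun x hx => by
    simp [hH, inner_add_right, inner_smul_right, (hP₂ x hx).2]
  have hτ : τ' = (-(n₁ / Real.cos θ)) • H₁ + (-(n₂ / Real.sin θ)) • H₂ := by
    rw [hτ', Finset.sum_union hdisj, sum_div_inner_smul_of_inner_eq_mul hmin₁ hH₁',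
      sum_div_inner_smul_of_inner_eq_mul hmin₂ hH₂', neg_add, neg_smul, neg_smul]
  have hτ₁' : ∀ x ∈ P₁, ⟪x, τ'⟫ = -(n₁ / Real.cos θ) * ⟪x, H₁⟫ := fun x hx => by
    rw [hτ, inner_add_right, inner_smul_right, inner_smul_right, (hP₁ x hx).2, mul_zero, add_zero]
  have hτ₂' : ∀ x ∈ P₂, ⟪x, τ'⟫ = -(n₂ / Real.sin θ) * ⟪x, H₂⟫ := fun x hx => by
    rw [hτ, inner_add_right, inner_smul_right, inner_smul_right, (hP₂ x hx).2, mul_zero, zero_add]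
  have hbi : τ₂ =
      (2 * ((n₁ : ℝ) + n₂) * -(n₁ / Real.cos θ) - n₁ * -(n₁ / Real.cos θ) / Real.cos θ ^ 2) • H₁ +
      (2 * ((n₁ : ℝ) + n₂) * -(n₂ / Real.sin θ) - n₂ * -(n₂ / Real.sin θ) / Real.sin θ ^ 2) • H₂ := by
    rw [hτ₂, Finset.sum_union hdisj,
      sum_mul_inner_div_sq_smul_of_inner_eq_mul hmin₁ (fun x hx => (hP₁ x hx).1.ne') hc.ne' hH₁'
        hτ₁',
      sum_mul_inner_div_sq_smul_of_inner_eq_mul hmin₂ (fun x hx => (hP₂ x hx).1.ne') hs.ne' hH₂'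
        hτ₂', hτ]
    module
  refine ⟨?_, fun hhalf hne => ?_⟩
  · rw [hbi, hH, exists_eq_smul_add_smul_iff hH₁ hH₂ hH₁₂ hc.ne']
    exact bitension_det_eq_zero_iff hn hc.ne' hs.ne' hcs
  · rw [hτ, hH, exists_eq_smul_add_smul_iff hH₁ hH₂ hH₁₂ hc.ne']
    intro h
    field_simp at h
    have hs2 : Real.sin θ ^ 2 = 1 / 2 := by linarith
    rw [hs2, hhalf] at h
    exact hne (by exact_mod_cast (by linarith : (n₁ : ℝ) = n₂))
end

section
/- Let θ ∈ (0, π/2), set H = cos θ·H₁ + sin θ·H₂, n = n₁ + n₂, and define τ̃_H = −Σ_{λ∈Σ₁⁺∪Σ₂⁺} m(λ)·λ/⟨λ,H⟩ and τ̃_{2,H} = 2n·τ̃_H − Σ_{λ∈Σ₁⁺∪Σ₂⁺} m(λ)·(⟨λ,τ̃_H⟩/⟨λ,H⟩²)·λ. Then τ̃_{2,H} = (1/cos θ)·(−2n·n₁ + n₁²/cos²θ)·H₁ + (1/sin θ)·(−2n·n₂ + n₂²/sin²θ)·H₂. -/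
open scoped RealInnerProductSpace

/-- If `⟪x, H⟫ = c * ⟪x, K⟫` on `P`, then passing from `K` to `H` scales the weighted sum
`∑ x ∈ P, (m x / ⟪x, K⟫) • x` by `1 / c`. -/
theorem sum_div_inner_smul_of_inner_eq {V : Type*} [NormedAddCommGroup V]
    [InnerProductSpace ℝ V] {P : Finset V} {m : V → ℕ} {H K : V} {c k : ℝ}
    (hH : ∀ x ∈ P, ⟪x, H⟫ = c * ⟪x, K⟫)
    (hmin : ∑ x ∈ P, ((m x : ℝ) / ⟪x, K⟫) • x = k • K) :
    ∑ x ∈ P, ((m x : ℝ) / ⟪x, H⟫) • x = (k / c) • K := by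
  calc ∑ x ∈ P, ((m x : ℝ) / ⟪x, H⟫) • x
      = (1 / c) • ∑ x ∈ P, ((m x : ℝ) / ⟪x, K⟫) • x := by
        rw [Finset.smul_sum]
        refine Finset.sum_congr rfl fun x hx => ?_
        rw [hH x hx, smul_smul, div_mul_div_comm, one_mul]
    _ = (k / c) • K := by rw [hmin, smul_smul, one_div_mul_eq_div]

/-- If `⟪x, H⟫ = c * ⟪x, K⟫` and `⟪x, T⟫ = d * ⟪x, K⟫` on `P`, then the second-order weighted sum
is the multiple `d / c ^ 2` of the first-order one. -/
theorem sum_inner_div_inner_sq_smul_of_inner_eq {V : Type*} [NormedAddCommGroup V]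
    [InnerProductSpace ℝ V] {P : Finset V} {m : V → ℕ} {H K T : V} {c d k : ℝ}
    (hK : ∀ x ∈ P, ⟪x, K⟫ ≠ 0)
    (hH : ∀ x ∈ P, ⟪x, H⟫ = c * ⟪x, K⟫) (hT : ∀ x ∈ P, ⟪x, T⟫ = d * ⟪x, K⟫)
    (hmin : ∑ x ∈ P, ((m x : ℝ) / ⟪x, K⟫) • x = k • K) :
    ∑ x ∈ P, ((m x : ℝ) * ⟪x, T⟫ / ⟪x, H⟫ ^ 2) • x = (d / c ^ 2 * k) • K := by
  rw [mul_smul, ← hmin, Finset.smul_sum]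
  refine Finset.sum_congr rfl fun x hx => ?_
  have hx0 := hK x hx
  rw [hH x hx, hT x hx, smul_smul]
  congr 1
  field_simp

/-- In the setting of a product of two minimal R-spaces: `H₁, H₂`
orthonormal, `P₁, P₂` disjoint nonempty finite sets of nonzero vectors with the root
conditions, positive multiplicities `m`, `nᵢ = Σ_{x∈Pᵢ} m x`, and the minimality
conditions `Σ_{x∈Pᵢ} m x · x/⟪x,Hᵢ⟫ = nᵢ·Hᵢ`.  For `θ ∈ (0, π/2)`,
`H = cos θ·H₁ + sin θ·H₂`, `n = n₁ + n₂`, `τ̃_H = −Σ_{x∈P₁∪P₂} m x · x/⟪x,H⟫`, and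
`τ̃_{2,H} = 2n·τ̃_H − Σ_{x∈P₁∪P₂} m x·(⟪x,τ̃_H⟫/⟪x,H⟫²)·x`, one has
`τ̃_{2,H} = (1/cos θ)·(−2n·n₁ + n₁²/cos²θ)·H₁ + (1/sin θ)·(−2n·n₂ + n₂²/sin²θ)·H₂`. -/
theorem bitension_field_formula {V : Type*} [NormedAddCommGroup V] [DecidableEq V]
    [InnerProductSpace ℝ V] [FiniteDimensional ℝ V]
    (H₁ H₂ : V) (hH₁ : ‖H₁‖ = 1) (hH₂ : ‖H₂‖ = 1) (hH₁₂ : ⟪H₁, H₂⟫ = 0)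
    (P₁ P₂ : Finset V) (hdisj : Disjoint P₁ P₂)
    (hP₁ne : P₁.Nonempty) (hP₂ne : P₂.Nonempty)
    (hP₁0 : ∀ x ∈ P₁, x ≠ 0) (hP₂0 : ∀ y ∈ P₂, y ≠ 0)
    (hP₁ : ∀ x ∈ P₁, 0 < ⟪x, H₁⟫ ∧ ⟪x, H₂⟫ = 0)
    (hP₂ : ∀ y ∈ P₂, 0 < ⟪y, H₂⟫ ∧ ⟪y, H₁⟫ = 0)
    (m : V → ℕ) (hm : ∀ x ∈ P₁ ∪ P₂, 0 < m x)
    (n₁ n₂ : ℕ) (hn₁ : n₁ = ∑ x ∈ P₁, m x) (hn₂ : n₂ = ∑ y ∈ P₂, m y)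
    (hmin₁ : ∑ x ∈ P₁, ((m x : ℝ) / ⟪x, H₁⟫) • x = (n₁ : ℝ) • H₁)
    (hmin₂ : ∑ y ∈ P₂, ((m y : ℝ) / ⟪y, H₂⟫) • y = (n₂ : ℝ) • H₂)
    (θ : ℝ) (hθ : θ ∈ Set.Ioo 0 (Real.pi / 2))
    (H : V) (hH : H = Real.cos θ • H₁ + Real.sin θ • H₂)
    (n : ℕ) (hn : n = n₁ + n₂)
    (τ' : V) (hτ' : τ' = -∑ x ∈ P₁ ∪ P₂, ((m x : ℝ) / ⟪x, H⟫) • x)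
    (τ₂ : V) (hτ₂ : τ₂ = (2 * n : ℝ) • τ' -
      ∑ x ∈ P₁ ∪ P₂, ((m x : ℝ) * ⟪x, τ'⟫ / ⟪x, H⟫ ^ 2) • x) :
    τ₂ = ((1 / Real.cos θ) * (-2 * n * n₁ + (n₁ : ℝ) ^ 2 / Real.cos θ ^ 2)) • H₁ +
      ((1 / Real.sin θ) * (-2 * n * n₂ + (n₂ : ℝ) ^ 2 / Real.sin θ ^ 2)) • H₂ := by
  have hc : Real.cos θ ≠ 0 :=
    (Real.cos_pos_of_mem_Ioo ⟨by linarith [hθ.1, Real.pi_pos], hθ.2⟩).ne'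
  have hs : Real.sin θ ≠ 0 :=
    (Real.sin_pos_of_pos_of_lt_pi hθ.1 (by linarith [hθ.2, Real.pi_pos])).ne'
  have hP₁H : ∀ x ∈ P₁, ⟪x, H⟫ = Real.cos θ * ⟪x, H₁⟫ := fun x hx => by
    simp [hH, inner_add_right, inner_smul_right, (hP₁ x hx).2]
  have hP₂H : ∀ y ∈ P₂, ⟪y, H⟫ = Real.sin θ * ⟪y, H₂⟫ := fun y hy => by
    simp [hH, inner_add_right, inner_smul_right, (hP₂ y hy).2]
  rw [Finset.sum_union hdisj, sum_div_inner_smul_of_inner_eq hP₁H hmin₁,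
    sum_div_inner_smul_of_inner_eq hP₂H hmin₂] at hτ'
  have hP₁τ : ∀ x ∈ P₁, ⟪x, τ'⟫ = -(n₁ / Real.cos θ) * ⟪x, H₁⟫ := fun x hx => by
    simp [hτ', inner_add_right, inner_smul_right, (hP₁ x hx).2]
  have hP₂τ : ∀ y ∈ P₂, ⟪y, τ'⟫ = -(n₂ / Real.sin θ) * ⟪y, H₂⟫ := fun y hy => by
    simp [hτ', inner_add_right, inner_smul_right, (hP₂ y hy).2]
  rw [hτ₂, Finset.sum_union hdisj,
    sum_inner_div_inner_sq_smul_of_inner_eq (fun x hx => (hP₁ x hx).1.ne') hP₁H hP₁τ hmin₁,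
    sum_inner_div_inner_sq_smul_of_inner_eq (fun y hy => (hP₂ y hy).1.ne') hP₂H hP₂τ hmin₂, hτ']
  match_scalars <;> field_simp <;> ring
end
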